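/- Let (a,b) ∈ ℝ² satisfy ω*(a,b) < 5, and let ψ : ℕ → ℝ_{≥0} be a decreasing function such that Σ_{n=1}^∞ ψ(n) log n < ∞. Then for Lebesgue-almost every β ∈ ℝ, setting α = aβ + b, there exist at most finitely many n ∈ ℕ for which ⟨nα⟩ ⟨nβ⟩ < ψ(n). -/

import Mathlib

/-!
Convergence theory on planar lines (Chow–Yang, Theorem 1.5): if `ω*(a,b) < 5`
and `ψ` is decreasing with `Σ ψ(n) log n < ∞`, then for almost every point
`(α,β)` on the line `α = aβ + b`, the inequality `⟨nα⟩⟨nβ⟩ < ψ(n)` has at most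
finitely many solutions `n ∈ ℕ`.
-/

open MeasureTheory

noncomputable section

/-- Distance from a real number to the nearest integer, `⟨x⟩`. -/
def distNearestInt (x : ℝ) : ℝ := |x - round x|

/-- `ω*(a,b) < 5`, where `ω*(a,b)` is the dual exponent of `(a,b)`: the supremum of
`w` such that `⟨xa + yb⟩ ≤ (|x|+|y|)^{-w}` for infinitely many nonzero `(x,y) ∈ ℤ²`.
Since the set of such `w` is an interval unbounded below, `ω*(a,b) < 5` is equivalent
to the existence of `w < 5` for which only finitely many nonzero `(x,y)` satisfy the
inequality. -/
def DualExpLtFive (a b : ℝ) : Prop :=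
  ∃ w : ℝ, w < 5 ∧
    {p : ℤ × ℤ | p ≠ 0 ∧
      distNearestInt (p.1 * a + p.2 * b) ≤ ((|p.1| + |p.2| : ℤ) : ℝ) ^ (-w)}.Finite

lemma dni_nonneg (x : ℝ) : 0 ≤ distNearestInt x := abs_nonneg _

lemma dni_le (x : ℝ) (j : ℤ) : distNearestInt x ≤ |x - j| := round_le x j

lemma dni_le_half (x : ℝ) : distNearestInt x ≤ 1 / 2 := abs_sub_round x

lemma one_le_size (p : ℤ × ℤ) (hp : p ≠ 0) : (1 : ℝ) ≤ ((|p.1| + |p.2| : ℤ) : ℝ) := by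
  have : (1 : ℤ) ≤ |p.1| + |p.2| := by
    rcases p with ⟨x, y⟩
    by_contra h
    have hx := abs_nonneg x
    have hy := abs_nonneg y
    simp only at h
    have h1 : |x| = 0 := by omega
    have h2 : |y| = 0 := by omega
    exact hp (by simp [abs_eq_zero.mp h1, abs_eq_zero.mp h2])
  exact_mod_cast this

lemma dual_lower (a b : ℝ) (hab : DualExpLtFive a b) :
    ∃ w c : ℝ, w < 5 ∧ 3 ≤ w ∧ 0 < c ∧ ∀ p : ℤ × ℤ, p ≠ 0 →
      c * ((|p.1| + |p.2| : ℤ) : ℝ) ^ (-w) ≤ distNearestInt (p.1 * a + p.2 * b) := by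
  obtain ⟨w, hw, hfin⟩ := hab
  set F := {p : ℤ × ℤ | p ≠ 0 ∧
      distNearestInt (p.1 * a + p.2 * b) ≤ ((|p.1| + |p.2| : ℤ) : ℝ) ^ (-w)} with hF
  have hpos : ∀ p : ℤ × ℤ, p ≠ 0 → 0 < distNearestInt (p.1 * a + p.2 * b) := by
    intro p hp
    refine lt_of_le_of_ne (dni_nonneg _) fun h0 => ?_
    have hinf : (Set.range fun t : ℕ => (((t : ℤ) + 1) * p.1, ((t : ℤ) + 1) * p.2)).Infinite := by
      apply Set.infinite_range_of_injective
      intro s t hst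
      simp only [Prod.mk.injEq] at hst
      by_cases h1 : p.1 = 0
      · have h2 : p.2 ≠ 0 := fun h2 => hp (Prod.ext h1 h2)
        have := mul_right_cancel₀ h2 hst.2
        omega
      · have := mul_right_cancel₀ h1 hst.1
        omega
    apply hinf
    refine hfin.subset ?_
    rintro _ ⟨t, rfl⟩
    refine ⟨?_, ?_⟩
    · intro h
      apply hp
      have ht : ((t : ℤ) + 1) ≠ 0 := by omega
      have e1 := congrArg Prod.fst h
      have e2 := congrArg Prod.snd h
      simp only [Prod.fst_zero, Prod.snd_zero, mul_eq_zero] at e1 e2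
      exact Prod.ext (by simpa [ht] using e1) (by simpa [ht] using e2)
    · have h1 : |(p.1 : ℝ) * a + p.2 * b - round ((p.1 : ℝ) * a + p.2 * b)| = 0 := h0.symm
      have h2 := abs_eq_zero.mp h1
      have h3 := dni_le ((((t : ℤ) + 1) * p.1 : ℤ) * a + (((t : ℤ) + 1) * p.2 : ℤ) * b)
        (((t : ℤ) + 1) * round ((p.1 : ℝ) * a + p.2 * b))
      have h4 : ((((t : ℤ) + 1) * p.1 : ℤ) * a + (((t : ℤ) + 1) * p.2 : ℤ) * b) -
        ((((t : ℤ) + 1) * round ((p.1 : ℝ) * a + p.2 * b) : ℤ) : ℝ) = 0 := by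
        push_cast
        linear_combination ((t : ℝ) + 1) * h2
      rw [h4, abs_zero] at h3
      refine h3.trans ?_
      apply Real.rpow_nonneg
      positivity
  set W := max w 3 with hW
  have hc : ∃ c : ℝ, 0 < c ∧ c ≤ 1 ∧ ∀ p ∈ F, c ≤ distNearestInt (p.1 * a + p.2 * b) := by
    by_cases hne : F.Nonempty
    · obtain ⟨p0, hp0, hmin⟩ := Set.exists_min_image F
        (fun p => distNearestInt (p.1 * a + p.2 * b)) hfin hne
      refine ⟨_, hpos p0 hp0.1, (dni_le_half _).trans (by norm_num), hmin⟩
    · rw [Set.not_nonempty_iff_eq_empty] at hne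
      exact ⟨1, one_pos, le_rfl, by simp [hne]⟩
  obtain ⟨c, hc0, hc1, hcF⟩ := hc
  refine ⟨W, c, max_lt hw (by norm_num), le_max_right _ _, hc0, fun p hp => ?_⟩
  have h1 := one_le_size p hp
  by_cases hpF : p ∈ F
  · have := hcF p hpF
    have h2 : ((|p.1| + |p.2| : ℤ) : ℝ) ^ (-W) ≤ 1 :=
      Real.rpow_le_one_of_one_le_of_nonpos h1 (by have := le_max_right w 3; linarith)
    nlinarith
  · have h3 : ((|p.1| + |p.2| : ℤ) : ℝ) ^ (-w) < distNearestInt (p.1 * a + p.2 * b) := by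
      by_contra h
      exact hpF ⟨hp, not_lt.mp h⟩
    have h4 : ((|p.1| + |p.2| : ℤ) : ℝ) ^ (-W) ≤ ((|p.1| + |p.2| : ℤ) : ℝ) ^ (-w) :=
      Real.rpow_le_rpow_of_exponent_le h1 (by have := le_max_left w 3; linarith)
    have h5 : 0 ≤ ((|p.1| + |p.2| : ℤ) : ℝ) ^ (-W) := Real.rpow_nonneg (by linarith) _
    nlinarith

lemma transfer (a b w c : ℝ) (hw : 3 ≤ w) (hc : 0 < c)
    (h : ∀ p : ℤ × ℤ, p ≠ 0 →
      c * ((|p.1| + |p.2| : ℤ) : ℝ) ^ (-w) ≤ distNearestInt (p.1 * a + p.2 * b))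
    (q : ℕ) (hq : 1 ≤ q) :
    c * 2 ^ (-w) / 2 * (q : ℝ) ^ (-((w - 1) / 2)) ≤
      max (distNearestInt (q * a)) (distNearestInt (q * b)) := by
  set X := Nat.sqrt q with hX
  set M := max (distNearestInt (q * a)) (distNearestInt (q * b)) with hM
  set p1 := round ((q : ℝ) * a)
  set p2 := round ((q : ℝ) * b)
  have hq0 : (q : ℤ) ≠ 0 := by omega
  have hcard : (Finset.Ico (0 : ℤ) q).card <
      (Finset.Icc (0 : ℤ) X ×ˢ Finset.Icc (0 : ℤ) X).card := by
    rw [Finset.card_product]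
    simp only [Int.card_Ico, Int.card_Icc]
    have := Nat.lt_succ_sqrt q
    have e : ((X : ℤ) + 1 - 0).toNat = X + 1 := by omega
    rw [e]
    simpa using this
  obtain ⟨u, hu, v, hv, huv, he⟩ := Finset.exists_ne_map_eq_of_card_lt_of_maps_to hcard
    (f := fun z : ℤ × ℤ => (z.1 * p1 + z.2 * p2) % (q : ℤ))
    (by
      intro z _
      simp only [Finset.coe_Ico, Set.mem_Ico]
      exact ⟨Int.emod_nonneg _ hq0, Int.emod_lt_of_pos _ (by omega)⟩)
  simp only [Finset.mem_product, Finset.mem_Icc] at hu hv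
  have hd : (q : ℤ) ∣ (u.1 * p1 + u.2 * p2) - (v.1 * p1 + v.2 * p2) :=
    Int.ModEq.dvd (Int.ModEq.symm he)
  obtain ⟨z, hz⟩ := hd
  have hne : u - v ≠ 0 := sub_ne_zero.mpr huv
  have hsz := one_le_size _ hne
  have h1 := h (u - v) hne
  have hx : |(u - v).1| ≤ X := by
    rw [Prod.fst_sub, abs_le]; omega
  have hy : |(u - v).2| ≤ X := by
    rw [Prod.snd_sub, abs_le]; omega
  have hxR : |((u - v).1 : ℝ)| ≤ X := by exact_mod_cast hx
  have hyR : |((u - v).2 : ℝ)| ≤ X := by exact_mod_cast hy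
  have hXq : (X : ℝ) ≤ √q := Real.nat_sqrt_le_real_sqrt
  have hq1 : (1 : ℝ) ≤ q := by exact_mod_cast hq
  have hsq : √(q : ℝ) * √q = q := Real.mul_self_sqrt (by linarith)
  have hsq0 : 0 < √(q : ℝ) := Real.sqrt_pos.mpr (by linarith)
  have e1 : |(q : ℝ) * a - p1| ≤ M := le_max_left _ _
  have e2 : |(q : ℝ) * b - p2| ≤ M := le_max_right _ _
  have hM0 : 0 ≤ M := (abs_nonneg _).trans e1
  have h2 : (q : ℝ) * distNearestInt ((u - v).1 * a + (u - v).2 * b) ≤ 2 * √q * M := by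
    have := dni_le ((u - v).1 * a + (u - v).2 * b) z
    have hzR : ((u - v).1 : ℝ) * p1 + ((u - v).2 : ℝ) * p2 = q * z := by
      have : (u - v).1 * p1 + (u - v).2 * p2 = q * z := by
        rw [← hz, Prod.fst_sub, Prod.snd_sub]; ring
      exact_mod_cast this
    calc (q : ℝ) * distNearestInt ((u - v).1 * a + (u - v).2 * b)
        ≤ q * |(u - v).1 * a + (u - v).2 * b - z| := by gcongr
      _ = |(q : ℝ) * ((u - v).1 * a + (u - v).2 * b - z)| := by
          rw [abs_mul, abs_of_nonneg (by linarith : (0 : ℝ) ≤ q)]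
      _ = |((u - v).1 : ℝ) * (q * a - p1) + (u - v).2 * (q * b - p2)| := by
          congr 1; linear_combination hzR
      _ ≤ |((u - v).1 : ℝ)| * |q * a - p1| + |((u - v).2 : ℝ)| * |q * b - p2| := by
          rw [← abs_mul, ← abs_mul]; exact abs_add_le _ _
      _ ≤ √q * M + √q * M := by
          gcongr
          · exact hxR.trans hXq
          · exact hyR.trans hXq
      _ = _ := by ring
  have h3 : (2 * √(q : ℝ)) ^ (-w) ≤ ((|(u - v).1| + |(u - v).2| : ℤ) : ℝ) ^ (-w) := by
    apply Real.rpow_le_rpow_of_nonpos (by linarith) _ (by linarith)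
    push_cast
    linarith
  have h4 : (q : ℝ) * (c * (2 * √(q : ℝ)) ^ (-w)) ≤ 2 * √q * M := by
    refine le_trans ?_ h2
    gcongr
    exact le_trans (by gcongr) h1
  have h5 : √(q : ℝ) * (c * (2 * √(q : ℝ)) ^ (-w)) / 2 ≤ M := by
    have : √(q : ℝ) * (√(q : ℝ) * (c * (2 * √(q : ℝ)) ^ (-w))) ≤ √q * (2 * M) := by
      rw [← mul_assoc, hsq]; linarith
    have := le_of_mul_le_mul_left this hsq0
    linarith
  refine le_trans (le_of_eq ?_) h5
  have : (q : ℝ) ^ (-((w - 1) / 2)) = √q * (√q) ^ (-w) := by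
    rw [Real.sqrt_eq_rpow, ← Real.rpow_mul (by linarith), ← Real.rpow_add (by linarith)]
    congr 1; ring
  rw [this, Real.mul_rpow (by norm_num) hsq0.le]
  ring

def ee (x : ℝ) : ℂ := Complex.exp (Complex.I * ((2 * Real.pi * x : ℝ) : ℂ))

lemma ee_add (x y : ℝ) : ee (x + y) = ee x * ee y := by
  unfold ee
  rw [← Complex.exp_add]
  congr 1
  push_cast
  ring

lemma ee_norm (x : ℝ) : ‖ee x‖ = 1 := by
  unfold ee
  rw [mul_comm]
  exact Complex.norm_exp_ofReal_mul_I _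

lemma ee_conj (x : ℝ) : (starRingEnd ℂ) (ee x) = ee (-x) := by
  unfold ee
  rw [← Complex.exp_conj]
  congr 1
  rw [map_mul, Complex.conj_I, Complex.conj_ofReal]
  push_cast
  ring

lemma ee_re (x : ℝ) : (ee x).re = Real.cos (2 * Real.pi * x) := by
  unfold ee
  rw [mul_comm, Complex.exp_ofReal_mul_I_re]

lemma ee_nat (i : ℕ) (x : ℝ) : ee (i * x) = ee x ^ i := by
  unfold ee
  rw [← Complex.exp_nat_mul]
  congr 1
  push_cast
  ring

lemma ee_sub_one (x : ℝ) : 4 * distNearestInt x ≤ ‖ee x - 1‖ := by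
  unfold ee
  rw [Complex.norm_exp_I_mul_ofReal_sub_one]
  rw [norm_mul, Real.norm_eq_abs, Real.norm_eq_abs, abs_two]
  have e : 2 * Real.pi * x / 2 = Real.pi * (x - round x) + (round x : ℤ) * Real.pi := by ring
  rw [e, Real.sin_add_int_mul_pi]
  rw [abs_mul, abs_zpow, abs_neg, abs_one, one_zpow, one_mul]
  set y := x - round x with hy
  have hd : distNearestInt x = |y| := rfl
  have hh : |y| ≤ 1 / 2 := dni_le_half x
  rw [hd]
  have hpi := Real.pi_pos
  have key : 2 / Real.pi * (Real.pi * |y|) ≤ Real.sin (Real.pi * |y|) :=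
    Real.mul_le_sin (by positivity) (by nlinarith)
  have e2 : 2 / Real.pi * (Real.pi * |y|) = 2 * |y| := by field_simp
  have e3 : Real.sin (Real.pi * |y|) ≤ |Real.sin (Real.pi * y)| := by
    rcases abs_choice y with h | h <;> rw [h]
    · exact le_abs_self _
    · rw [mul_neg, Real.sin_neg]; exact neg_le_abs _
  linarith

def EE (H : ℕ) (x : ℝ) : ℂ := ∑ i ∈ Finset.range H, ee (i * x)

lemma EE_le (H : ℕ) (x : ℝ) : ‖EE H x‖ ≤ H := by
  unfold EE
  refine (norm_sum_le _ _).trans ?_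
  simp [ee_norm]

lemma EE_le' (H : ℕ) (x : ℝ) : 2 * ‖EE H x‖ * distNearestInt x ≤ 1 := by
  have h1 : EE H x * (ee x - 1) = ee x ^ H - 1 := by
    unfold EE
    simp_rw [ee_nat]
    exact geom_sum_mul _ _
  have h2 : ‖EE H x‖ * ‖ee x - 1‖ ≤ 2 := by
    rw [← norm_mul, h1]
    refine (norm_sub_le _ _).trans ?_
    rw [norm_pow, ee_norm]; norm_num
  have h3 := ee_sub_one x
  have := mul_le_mul_of_nonneg_left h3 (norm_nonneg (EE H x))
  linarith

def gg (H : ℕ) (c : ℕ) : ℝ :=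
  6 * (H : ℝ) ^ 2 * (1 / (((c : ℝ) + 1) * (c + 2)) +
    1 / ((((H - 1 - c : ℕ) : ℝ) + 1) * (((H - 1 - c : ℕ) : ℝ) + 2)))

lemma gg_nonneg (H c : ℕ) : 0 ≤ gg H c := by unfold gg; positivity

lemma aux_sum (n : ℕ) : ∑ c ∈ Finset.range n, 1 / (((c : ℝ) + 1) * (c + 2)) = 1 - 1 / (n + 1) := by
  induction n with
  | zero => simp
  | succ n ih =>
    rw [Finset.sum_range_succ, ih]
    push_cast
    field_simp
    ring

lemma gg_sum (H : ℕ) : ∑ c ∈ Finset.range H, gg H c ≤ 12 * (H : ℝ) ^ 2 := by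
  unfold gg
  rw [← Finset.mul_sum, Finset.sum_add_distrib,
    Finset.sum_range_reflect (fun c : ℕ => 1 / (((c : ℝ) + 1) * (c + 2))) H, aux_sum]
  have : (0 : ℝ) ≤ 1 / ((H : ℝ) + 1) := by positivity
  nlinarith [sq_nonneg (H : ℝ)]

lemma aux_bound (e h c : ℝ) (he : 0 ≤ e) (hc : 0 ≤ c) (h1 : e ≤ h) (h2 : 2 * e * c ≤ h) :
    e ^ 2 ≤ 6 * h ^ 2 * (1 / ((c + 1) * (c + 2))) := by
  rw [mul_one_div, le_div_iff₀ (by positivity)]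
  have hh : 0 ≤ h := he.trans h1
  have a1 : (2 * e * c) * (2 * e * c) ≤ h * h := by gcongr
  have a2 : e * (2 * e * c) ≤ h * h := by gcongr
  have a3 : e * e ≤ h * h := by gcongr
  nlinarith

lemma EE_gg (H : ℕ) (hH : 1 ≤ H) (x : ℝ) :
    ⌊H * Int.fract x⌋₊ < H ∧ ‖EE H x‖ ^ 2 ≤ gg H ⌊H * Int.fract x⌋₊ := by
  have hH0 : (0 : ℝ) < H := by exact_mod_cast hH
  have f0 := Int.fract_nonneg x
  have f1 := Int.fract_lt_one x
  have hlt : ⌊H * Int.fract x⌋₊ < H := by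
    rw [Nat.floor_lt (by positivity)]
    nlinarith
  refine ⟨hlt, ?_⟩
  set c := ⌊H * Int.fract x⌋₊ with hc
  have c1 : (c : ℝ) ≤ H * Int.fract x := Nat.floor_le (by positivity)
  have c2 : H * Int.fract x < c + 1 := Nat.lt_floor_add_one _
  have hE := EE_le H x
  have hE' := EE_le' H x
  have hd : distNearestInt x = min (Int.fract x) (1 - Int.fract x) := abs_sub_round_eq_min x
  have he0 := norm_nonneg (EE H x)
  unfold gg
  rw [mul_add]
  rcases le_total (Int.fract x) (1 - Int.fract x) with h | h
  · rw [min_eq_left h] at hd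
    rw [hd] at hE'
    have := aux_bound ‖EE H x‖ H c he0 (by positivity) hE (by nlinarith)
    have h0 : 0 ≤ 6 * (H : ℝ) ^ 2 * (1 / ((((H - 1 - c : ℕ) : ℝ) + 1) * (((H - 1 - c : ℕ) : ℝ) + 2))) := by
      positivity
    linarith
  · rw [min_eq_right h] at hd
    rw [hd] at hE'
    have hcast : ((H - 1 - c : ℕ) : ℝ) = H - 1 - c := by
      rw [Nat.cast_sub (by omega), Nat.cast_sub hH]; simp
    have hk : ((H - 1 - c : ℕ) : ℝ) ≤ H * (1 - Int.fract x) := by rw [hcast]; linarith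
    have := aux_bound ‖EE H x‖ H ((H - 1 - c : ℕ) : ℝ) he0 (by positivity) hE (by nlinarith)
    have h0 : 0 ≤ 6 * (H : ℝ) ^ 2 * (1 / (((c : ℝ) + 1) * (c + 2))) := by
      positivity
    linarith

lemma same_cell (H : ℕ) (hH : 1 ≤ H) (x y : ℝ)
    (h : ⌊H * Int.fract x⌋₊ = ⌊H * Int.fract y⌋₊) : distNearestInt (x - y) < 1 / H := by
  have hH0 : (0 : ℝ) < H := by exact_mod_cast hH
  have fx := Int.fract_nonneg x
  have fy := Int.fract_nonneg y
  have a1 := Nat.floor_le (show 0 ≤ H * Int.fract x by positivity)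
  have a2 := Nat.lt_floor_add_one (H * Int.fract x)
  have b1 := Nat.floor_le (show 0 ≤ H * Int.fract y by positivity)
  have b2 := Nat.lt_floor_add_one (H * Int.fract y)
  rw [h] at a1 a2
  refine (dni_le (x - y) (⌊x⌋ - ⌊y⌋)).trans_lt ?_
  have e : x - y - ((⌊x⌋ - ⌊y⌋ : ℤ) : ℝ) = Int.fract x - Int.fract y := by
    push_cast; unfold Int.fract; ring
  rw [e, lt_div_iff₀ hH0, ← abs_of_pos hH0, ← abs_mul, abs_lt]
  constructor <;> nlinarith

lemma sep_sum (a b : ℝ) (H T : ℕ) (hH : 1 ≤ H)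
    (hsep : ∀ q : ℕ, 1 ≤ q → q < T →
      1 / (H : ℝ) ≤ max (distNearestInt (q * a)) (distNearestInt (q * b))) (w' : ℕ) :
    ∑ w ∈ Finset.range T, ‖EE H (((w : ℝ) - w') * a)‖ ^ 2 * ‖EE H (((w : ℝ) - w') * b)‖ ^ 2
      ≤ 144 * (H : ℝ) ^ 4 := by
  set φ : ℕ → ℕ × ℕ := fun w => (⌊H * Int.fract (((w : ℝ) - w') * a)⌋₊,
    ⌊H * Int.fract (((w : ℝ) - w') * b)⌋₊) with hφ
  have hlt : ∀ w1 < T, ∀ w2 < T, w1 < w2 → φ w1 ≠ φ w2 := by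
    intro w1 h1 w2 h2 h12 he
    rw [hφ] at he
    simp only [Prod.mk.injEq] at he
    have ha := same_cell H hH _ _ he.1.symm
    have hb := same_cell H hH _ _ he.2.symm
    have := hsep (w2 - w1) (by omega) (by omega)
    rw [Nat.cast_sub h12.le] at this
    have e1 : ((w2 : ℝ) - w') * a - (w1 - w') * a = (w2 - w1) * a := by ring
    have e2 : ((w2 : ℝ) - w') * b - (w1 - w') * b = (w2 - w1) * b := by ring
    rw [e1] at ha
    rw [e2] at hb
    exact absurd this (not_le.mpr (max_lt ha hb))
  have hinj : Set.InjOn φ (Finset.range T) := by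
    intro w1 h1 w2 h2 he
    simp only [Finset.coe_range, Set.mem_Iio] at h1 h2
    rcases lt_trichotomy w1 w2 with h | h | h
    · exact absurd he (hlt _ h1 _ h2 h)
    · exact h
    · exact absurd he.symm (hlt _ h2 _ h1 h)
  calc _ ≤ ∑ w ∈ Finset.range T, gg H (φ w).1 * gg H (φ w).2 := by
        apply Finset.sum_le_sum
        intro w _
        exact mul_le_mul (EE_gg H hH _).2 (EE_gg H hH _).2 (by positivity) (gg_nonneg _ _)
    _ = ∑ z ∈ (Finset.range T).image φ, gg H z.1 * gg H z.2 := by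
        rw [Finset.sum_image hinj]
    _ ≤ ∑ z ∈ Finset.range H ×ˢ Finset.range H, gg H z.1 * gg H z.2 := by
        apply Finset.sum_le_sum_of_subset_of_nonneg
        · intro z hz
          obtain ⟨w, _, rfl⟩ := Finset.mem_image.mp hz
          simp only [Finset.mem_product, Finset.mem_range]
          exact ⟨(EE_gg H hH _).1, (EE_gg H hH _).1⟩
        · intro z _ _
          exact mul_nonneg (gg_nonneg _ _) (gg_nonneg _ _)
    _ = (∑ c ∈ Finset.range H, gg H c) * (∑ c ∈ Finset.range H, gg H c) := by
        rw [Finset.sum_product, Finset.sum_mul_sum]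
    _ ≤ (12 * (H : ℝ) ^ 2) * (12 * (H : ℝ) ^ 2) := by
        have h0 : 0 ≤ ∑ c ∈ Finset.range H, gg H c := Finset.sum_nonneg fun _ _ => gg_nonneg _ _
        have := gg_sum H
        gcongr
    _ = _ := by ring

lemma normsq_EE (T : ℕ) (x : ℝ) : ((‖EE T x‖ ^ 2 : ℝ) : ℂ) =
    ∑ w ∈ Finset.range T, ∑ w' ∈ Finset.range T, ee (((w : ℝ) - w') * x) := by
  have : ((‖EE T x‖ ^ 2 : ℝ) : ℂ) = EE T x * (starRingEnd ℂ) (EE T x) := by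
    rw [Complex.mul_conj, Complex.normSq_eq_norm_sq]
  rw [this]
  unfold EE
  rw [map_sum, Finset.sum_mul_sum]
  refine Finset.sum_congr rfl fun w _ => Finset.sum_congr rfl fun w' _ => ?_
  rw [ee_conj, ← ee_add]
  congr 1; ring

lemma duality (a b : ℝ) (H T : ℕ) :
    ∑ i' ∈ Finset.range H, ∑ l' ∈ Finset.range H, ∑ i ∈ Finset.range H, ∑ l ∈ Finset.range H,
      ‖EE T (((i : ℝ) - i') * a + ((l : ℝ) - l') * b)‖ ^ 2 =
    ∑ w' ∈ Finset.range T, ∑ w ∈ Finset.range T,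
      ‖EE H (((w : ℝ) - w') * a)‖ ^ 2 * ‖EE H (((w : ℝ) - w') * b)‖ ^ 2 := by
  apply Complex.ofReal_injective
  simp only [Complex.ofReal_sum, Complex.ofReal_mul]
  simp only [normsq_EE]
  have L : ∀ i' l' i l : ℕ, ∑ w ∈ Finset.range T, ∑ w' ∈ Finset.range T,
      ee (((w : ℝ) - w') * (((i : ℝ) - i') * a + ((l : ℝ) - l') * b)) =
      ∑ z ∈ Finset.range T ×ˢ Finset.range T, ee (((i : ℝ) - i') * ((z.2 - z.1) * a)) *
        ee (((l : ℝ) - l') * ((z.2 - z.1) * b)) := by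
    intro i' l' i l
    rw [Finset.sum_comm, Finset.sum_product]
    refine Finset.sum_congr rfl fun w _ => Finset.sum_congr rfl fun w' _ => ?_
    rw [← ee_add]
    congr 1; ring
  simp_rw [L]
  rw [← Finset.sum_product (Finset.range T) (Finset.range T)
    (fun z : ℕ × ℕ => (∑ w ∈ Finset.range H, ∑ w' ∈ Finset.range H, ee (((w : ℝ) - w') * (((z.2 : ℝ) - z.1) * a))) *
      ∑ w ∈ Finset.range H, ∑ w' ∈ Finset.range H, ee (((w : ℝ) - w') * (((z.2 : ℝ) - z.1) * b)))]
  have S : ∀ f : ℕ × ℕ → ℕ → ℂ, ∑ i ∈ Finset.range H, ∑ z ∈ Finset.range T ×ˢ Finset.range T, f z i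
     = ∑ z ∈ Finset.range T ×ˢ Finset.range T, ∑ i ∈ Finset.range H, f z i := fun f => Finset.sum_comm
  have S' : ∀ (g : ℕ → ℕ × ℕ → ℂ), ∑ i ∈ Finset.range H, ∑ z ∈ Finset.range T ×ˢ Finset.range T, g i z
     = ∑ z ∈ Finset.range T ×ˢ Finset.range T, ∑ i ∈ Finset.range H, g i z := fun f => Finset.sum_comm
  simp_rw [S']
  refine Finset.sum_congr rfl fun z _ => ?_
  rw [Finset.sum_comm (s := Finset.range H) (t := Finset.range H)
    (f := fun w w' : ℕ => ee (((w : ℝ) - w') * (((z.2 : ℝ) - z.1) * a))),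
    Finset.sum_comm (s := Finset.range H) (t := Finset.range H)
    (f := fun w w' : ℕ => ee (((w : ℝ) - w') * (((z.2 : ℝ) - z.1) * b)))]
  rw [Finset.sum_mul_sum]
  refine Finset.sum_congr rfl fun i' _ => Finset.sum_congr rfl fun l' _ => ?_
  rw [Finset.sum_mul_sum]

lemma EE_lower (T : ℕ) (x : ℝ) (h : 8 * (T : ℝ) * distNearestInt x ≤ 1) :
    (T : ℝ) / 2 ≤ ‖EE T x‖ := by
  refine le_trans ?_ (Complex.re_le_norm _)
  unfold EE
  rw [Complex.re_sum]
  have : ∀ w ∈ Finset.range T, (1 / 2 : ℝ) ≤ (ee (w * x)).re := by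
    intro w hw
    have hwT : (w : ℝ) ≤ T := by exact_mod_cast (Finset.mem_range.mp hw).le
    rw [ee_re]
    have e : 2 * Real.pi * (w * x) = 2 * Real.pi * w * (x - round x) +
      ((w * round x : ℤ) : ℝ) * (2 * Real.pi) := by push_cast; ring
    rw [e, Real.cos_add_int_mul_two_pi]
    refine le_trans ?_ (Real.one_sub_sq_div_two_le_cos)
    have h1 : |2 * Real.pi * w * (x - round x)| ≤ 1 := by
      rw [abs_mul, abs_of_nonneg (by positivity)]
      have hd : |x - round x| = distNearestInt x := rfl
      rw [hd]
      have h0 := dni_nonneg x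
      have h2 : (w : ℝ) * distNearestInt x ≤ T * distNearestInt x := by gcongr
      have h3 : 0 ≤ (w : ℝ) * distNearestInt x := by positivity
      have := Real.pi_lt_four
      have := Real.pi_pos
      nlinarith
    have := sq_le_one_iff_abs_le_one _ |>.mpr h1
    linarith
  calc (T : ℝ) / 2 = ∑ w ∈ Finset.range T, (1 / 2 : ℝ) := by simp; ring
    _ ≤ _ := Finset.sum_le_sum this

lemma count (a b : ℝ) (N T : ℕ) (hN : 1 ≤ N) (hT : 1 ≤ T)
    (hsep : ∀ q : ℕ, 1 ≤ q → q < T →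
      1 / ((3 * N : ℕ) : ℝ) ≤ max (distNearestInt (q * a)) (distNearestInt (q * b)))
    (S : Finset (ℤ × ℤ)) (hS : ∀ s ∈ S, |s.1| ≤ N ∧ |s.2| ≤ N ∧
      8 * (T : ℝ) * distNearestInt (s.1 * a + s.2 * b) ≤ 1) :
    (S.card : ℝ) * T ≤ 46656 * (N : ℝ) ^ 2 := by
  have hN0 : (0 : ℝ) < N := by exact_mod_cast hN
  have hT0 : (0 : ℝ) < T := by exact_mod_cast hT
  set H := 3 * N with hH
  have up : ∑ w' ∈ Finset.range T, ∑ w ∈ Finset.range T,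
      ‖EE H (((w : ℝ) - w') * a)‖ ^ 2 * ‖EE H (((w : ℝ) - w') * b)‖ ^ 2 ≤
      T * (144 * (H : ℝ) ^ 4) := by
    refine (Finset.sum_le_sum fun w' _ => sep_sum a b H T (by omega) hsep w').trans ?_
    simp
  rw [← duality] at up
  set f : ℝ → ℝ → ℝ := fun k n => ‖EE T (k * a + n * b)‖ ^ 2 with hf
  have inner : ∀ i' ∈ Finset.Ico N (2 * N), ∀ l' ∈ Finset.Ico N (2 * N),
      (S.card : ℝ) * (T / 2) ^ 2 ≤ ∑ i ∈ Finset.range H, ∑ l ∈ Finset.range H,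
      ‖EE T (((i : ℝ) - i') * a + ((l : ℝ) - l') * b)‖ ^ 2 := by
    intro i' hi' l' hl'
    rw [Finset.mem_Ico] at hi' hl'
    rw [← Finset.sum_product' (Finset.range H) (Finset.range H)
      (fun i l : ℕ => ‖EE T (((i : ℝ) - i') * a + ((l : ℝ) - l') * b)‖ ^ 2)]
    set ρ : ℤ × ℤ → ℕ × ℕ := fun s => ((s.1 + i').toNat, (s.2 + l').toNat) with hρ
    have hb : ∀ s ∈ S, 0 ≤ s.1 + i' ∧ s.1 + i' < H ∧ 0 ≤ s.2 + l' ∧ s.2 + l' < H := by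
      intro s hs
      obtain ⟨h1, h2, _⟩ := hS s hs
      rw [abs_le] at h1 h2
      omega
    have hinj : Set.InjOn ρ S := by
      intro s hs t ht he
      have := hb s hs
      have := hb t ht
      simp only [hρ, Prod.mk.injEq] at he
      apply Prod.ext <;> omega
    calc (S.card : ℝ) * (T / 2) ^ 2 = ∑ s ∈ S, ((T : ℝ) / 2) ^ 2 := by simp
      _ ≤ ∑ s ∈ S, ‖EE T ((((ρ s).1 : ℝ) - i') * a + (((ρ s).2 : ℝ) - l') * b)‖ ^ 2 := by
          apply Finset.sum_le_sum
          intro s hs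
          have hbs := hb s hs
          have e1 : (((ρ s).1 : ℝ) - i') = s.1 := by
            have : (((ρ s).1 : ℤ) - i') = s.1 := by simp only [hρ]; omega
            exact_mod_cast this
          have e2 : (((ρ s).2 : ℝ) - l') = s.2 := by
            have : (((ρ s).2 : ℤ) - l') = s.2 := by simp only [hρ]; omega
            exact_mod_cast this
          rw [e1, e2]
          have := EE_lower T _ (hS s hs).2.2
          gcongr
      _ = ∑ z ∈ S.image ρ, ‖EE T (((z.1 : ℝ) - i') * a + ((z.2 : ℝ) - l') * b)‖ ^ 2 := by
          rw [Finset.sum_image hinj]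
      _ ≤ _ := by
          apply Finset.sum_le_sum_of_subset_of_nonneg
          · intro z hz
            obtain ⟨s, hs, rfl⟩ := Finset.mem_image.mp hz
            have := hb s hs
            simp only [Finset.mem_product, Finset.mem_range, hρ]
            omega
          · intros; positivity
  have sub : Finset.Ico N (2 * N) ⊆ Finset.range H := by
    intro x hx
    rw [Finset.mem_Ico] at hx
    rw [Finset.mem_range]; omega
  have low : (N : ℝ) * (N * ((S.card : ℝ) * (T / 2) ^ 2)) ≤
      T * (144 * (H : ℝ) ^ 4) := by
    refine le_trans ?_ up
    calc (N : ℝ) * (N * ((S.card : ℝ) * (T / 2) ^ 2))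
        = ∑ i' ∈ Finset.Ico N (2 * N), ∑ l' ∈ Finset.Ico N (2 * N),
          (S.card : ℝ) * (T / 2) ^ 2 := by
          have : 2 * N - N = N := by omega
          simp [this]
      _ ≤ ∑ i' ∈ Finset.Ico N (2 * N), ∑ l' ∈ Finset.Ico N (2 * N),
          ∑ i ∈ Finset.range H, ∑ l ∈ Finset.range H,
      ‖EE T (((i : ℝ) - i') * a + ((l : ℝ) - l') * b)‖ ^ 2 :=
          Finset.sum_le_sum fun i' hi' => Finset.sum_le_sum fun l' hl' => inner i' hi' l' hl'
      _ ≤ ∑ i' ∈ Finset.Ico N (2 * N), ∑ l' ∈ Finset.range H,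
          ∑ i ∈ Finset.range H, ∑ l ∈ Finset.range H,
      ‖EE T (((i : ℝ) - i') * a + ((l : ℝ) - l') * b)‖ ^ 2 := by
          refine Finset.sum_le_sum fun i' _ => ?_
          exact Finset.sum_le_sum_of_subset_of_nonneg sub fun _ _ _ => by positivity
      _ ≤ _ := Finset.sum_le_sum_of_subset_of_nonneg sub fun _ _ _ => by positivity
  have hHc : (H : ℝ) = 3 * N := by rw [hH]; push_cast; ring
  rw [hHc] at low
  have e1 : (N : ℝ) * (N * ((S.card : ℝ) * (T / 2) ^ 2)) =
    ((N : ℝ) ^ 2 * T / 4) * (S.card * T) := by ring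
  have e2 : (T : ℝ) * (144 * (3 * (N : ℝ)) ^ 4) = ((N : ℝ) ^ 2 * T / 4) * (46656 * (N : ℝ) ^ 2) := by
    ring
  rw [e1, e2] at low
  exact le_of_mul_le_mul_left low (by positivity)

lemma cover (a b R : ℝ) (ha : a ≠ 0) (L A : ℕ) (hL : 2 * R + 1 ≤ L) (hL2 : 2 ≤ L)
    (hA : |a| + 1 ≤ A) (N : ℕ) (hN : 1 ≤ N) (Ψ : ℝ) (hΨ0 : 0 < Ψ) (hΨ1 : Ψ ≤ 1)
    (β : ℝ) (hβ : |β| ≤ R) (n : ℕ) (hn1 : N ≤ n) (hn2 : n < 2 * N)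
    (h : distNearestInt (n * (a * β + b)) * distNearestInt (n * β) < Ψ) :
    ∃ i : ℕ, 4 ^ i * Ψ ≤ 1 ∧ ∃ k : ℤ, |k| ≤ L * N ∧
      2 ^ i * distNearestInt (k * a + n * b) ≤ A ∧
      ∃ t ∈ Finset.Icc (-(A + 1) : ℤ) (A + 1),
      (β ∈ Metric.closedBall ((k : ℝ) / n) (2 * Ψ * 2 ^ i / N) ∨
        β ∈ Metric.closedBall (((round ((k : ℝ) * a + n * b) : ℝ) + t - n * b) / (n * a))
          (2 * Ψ * 2 ^ i / N / |a|)) := by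
  have hN0 : (0 : ℝ) < N := by exact_mod_cast hN
  have hn1' : (N : ℝ) ≤ n := by exact_mod_cast hn1
  have hn2' : (n : ℝ) ≤ 2 * N := by exact_mod_cast hn2.le
  have hn0 : (0 : ℝ) < n := by linarith
  have ha0 : 0 < |a| := abs_pos.mpr ha
  set x := distNearestInt (n * (a * β + b)) with hx
  set y := distNearestInt (n * β) with hy
  have x0 : 0 ≤ x := dni_nonneg _
  have y0 : 0 ≤ y := dni_nonneg _
  have x1 : x ≤ 1 / 2 := dni_le_half _
  have y1 : y ≤ 1 / 2 := dni_le_half _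
  set z := max (max x y) (√Ψ) with hz
  have sΨ : √Ψ * √Ψ = Ψ := Real.mul_self_sqrt hΨ0.le
  have sΨ0 : 0 < √Ψ := Real.sqrt_pos.mpr hΨ0
  have sΨ1 : √Ψ ≤ 1 := Real.sqrt_le_iff.mpr ⟨by norm_num, by linarith⟩
  have z0 : 0 < z := lt_of_lt_of_le sΨ0 (le_max_right _ _)
  have z1 : z ≤ 1 := max_le (max_le (by linarith) (by linarith)) sΨ1
  have hmz : min x y * z ≤ Ψ := by
    rcases le_total (max x y) (√Ψ) with hc | hc
    · rw [hz, max_eq_right hc]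
      calc min x y * √Ψ ≤ √Ψ * √Ψ := by
            gcongr
            exact (min_le_max).trans hc
        _ = Ψ := sΨ
    · rw [hz, max_eq_left hc, min_mul_max]
      exact h.le
  obtain ⟨i, hi1, hi2⟩ := exists_nat_pow_near_of_lt_one z0 z1 (y := (1 / 2 : ℝ)) (by norm_num) (by norm_num)
  have p0 : (0 : ℝ) < 2 ^ i := by positivity
  have hzi : 2 ^ i * z ≤ 1 := by
    calc 2 ^ i * z ≤ 2 ^ i * (1 / 2) ^ i := by gcongr
      _ = 1 := by rw [← mul_pow]; norm_num
  have hzi' : 1 ≤ 2 * 2 ^ i * z := by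
    calc (1 : ℝ) = 2 * 2 ^ i * (1 / 2) ^ (i + 1) := by
          rw [← pow_succ', ← mul_pow]; norm_num
      _ ≤ _ := by gcongr
  have hmin : min x y ≤ 2 * Ψ * 2 ^ i := by
    have m0 : 0 ≤ min x y := le_min x0 y0
    calc min x y ≤ min x y * (2 * 2 ^ i * z) := le_mul_of_one_le_right m0 hzi'
      _ = 2 * 2 ^ i * (min x y * z) := by ring
      _ ≤ 2 * 2 ^ i * Ψ := by gcongr
      _ = _ := by ring
  have hxi : 2 ^ i * x ≤ 1 := by
    refine le_trans ?_ hzi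
    gcongr
    exact (le_max_left _ _).trans (le_max_left _ _)
  have hyi : 2 ^ i * y ≤ 1 := by
    refine le_trans ?_ hzi
    gcongr
    exact (le_max_right _ _).trans (le_max_left _ _)
  set k := round ((n : ℝ) * β) with hk
  set j := round ((n : ℝ) * (a * β + b)) with hj
  have ex : |(n : ℝ) * (a * β + b) - j| = x := rfl
  have ey : |(n : ℝ) * β - k| = y := rfl
  have hkj : |(k : ℝ) * a + n * b - j| ≤ x + |a| * y := by
    rw [← ex, ← ey, ← abs_mul]
    have : (k : ℝ) * a + n * b - j = (n * (a * β + b) - j) - a * (n * β - k) := by ring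
    rw [this]
    exact abs_sub _ _
  refine ⟨i, ?_, k, ?_, ?_, j - round ((k : ℝ) * a + n * b), ?_, ?_⟩
  · have : 2 ^ i * √Ψ ≤ 1 := le_trans (by gcongr; exact le_max_right _ _) hzi
    calc (4 : ℝ) ^ i * Ψ = (2 ^ i * √Ψ) * (2 ^ i * √Ψ) := by
          rw [mul_mul_mul_comm, sΨ, ← mul_pow]; norm_num
      _ ≤ 1 * 1 := by gcongr
      _ = 1 := by norm_num
  · have h1 : |(k : ℝ)| ≤ n * |β| + 1 / 2 := by
      have e : (k : ℝ) = n * β - (n * β - k) := by ring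
      calc |(k : ℝ)| = |n * β - (n * β - k)| := by rw [← e]
        _ ≤ |n * β| + |n * β - k| := abs_sub _ _
        _ ≤ _ := by rw [ey, abs_mul, abs_of_pos hn0]; linarith
    have hN1 : (1 : ℝ) ≤ N := by exact_mod_cast hN
    have h2 : |(k : ℝ)| ≤ L * N := by
      have hβ0 := abs_nonneg β
      have : (n : ℝ) * |β| ≤ 2 * N * R := by gcongr
      nlinarith
    exact_mod_cast h2
  · have h1 := (dni_le ((k : ℝ) * a + n * b) j).trans hkj
    calc 2 ^ i * distNearestInt (k * a + n * b) ≤ 2 ^ i * (x + |a| * y) := by gcongr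
      _ = 2 ^ i * x + |a| * (2 ^ i * y) := by ring
      _ ≤ 1 + |a| * 1 := by gcongr
      _ ≤ A := by linarith
  · rw [Finset.mem_Icc, ← abs_le]
    have h1 : |((j - round ((k : ℝ) * a + n * b) : ℤ) : ℝ)| ≤ A + 1 := by
      have e : ((j - round ((k : ℝ) * a + n * b) : ℤ) : ℝ) =
        ((k : ℝ) * a + n * b - round ((k : ℝ) * a + n * b)) - (k * a + n * b - j) := by
        push_cast; ring
      rw [e]
      refine (abs_sub _ _).trans ?_
      have := abs_sub_round ((k : ℝ) * a + n * b)
      nlinarith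
    exact_mod_cast h1
  · rcases le_total y x with hxy | hxy
    · left
      rw [min_eq_right hxy] at hmin
      rw [Metric.mem_closedBall, Real.dist_eq]
      have e : β - k / n = (n * β - k) / n := by field_simp
      rw [e, abs_div, ey, abs_of_pos hn0]
      gcongr
    · right
      rw [min_eq_left hxy] at hmin
      rw [Metric.mem_closedBall, Real.dist_eq]
      have e : β - ((round ((k : ℝ) * a + n * b) : ℝ) +
          ((j - round ((k : ℝ) * a + n * b) : ℤ) : ℝ) - n * b) / (n * a) =
          (n * (a * β + b) - j) / n / a := by
        push_cast
        field_simp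
        ring
      rw [e, abs_div, abs_div, ex, abs_of_pos hn0]
      gcongr

lemma union_le {ι : Type*} (F : Finset ι) (X : ι → Set ℝ) (r : ℝ)
    (h : ∀ t ∈ F, volume (X t) ≤ ENNReal.ofReal r) :
    volume (⋃ t ∈ F, X t) ≤ ENNReal.ofReal (F.card * r) := by
  refine (measure_biUnion_finset_le _ _).trans ?_
  refine (Finset.sum_le_sum h).trans ?_
  rw [Finset.sum_const, nsmul_eq_mul, ENNReal.ofReal_mul (by positivity), ENNReal.ofReal_natCast]

lemma cardS (a b : ℝ) (L A e : ℕ) (hL2 : 2 ≤ L) (he : 8 * A ≤ 2 ^ e) (N : ℕ) (hN : 1 ≤ N) (i : ℕ)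
    (hsep : ∀ q : ℕ, 1 ≤ q → q < 2 ^ i →
      1 / ((3 * (L * N) : ℕ) : ℝ) ≤ max (distNearestInt (q * a)) (distNearestInt (q * b)))
    (S : Finset (ℤ × ℤ)) (hS : ∀ s ∈ S, |s.1| ≤ L * N ∧ |s.2| ≤ L * N ∧
      2 ^ i * distNearestInt (s.1 * a + s.2 * b) ≤ A) :
    (S.card : ℝ) * 2 ^ i ≤ 46656 * L ^ 2 * 2 ^ e * (N : ℝ) ^ 2 := by
  have hLN : 1 ≤ L * N := Nat.mul_pos (by omega) hN
  rcases lt_or_ge i e with hi | hi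
  · have h1 : S ⊆ Finset.Icc (-(L * N : ℤ)) (L * N) ×ˢ Finset.Icc (-(L * N : ℤ)) (L * N) := by
      intro s hs
      obtain ⟨h1, h2, _⟩ := hS s hs
      rw [Finset.mem_product, Finset.mem_Icc, Finset.mem_Icc, ← abs_le, ← abs_le]
      exact ⟨h1, h2⟩
    have h2 := Finset.card_le_card h1
    rw [Finset.card_product] at h2
    simp only [Int.card_Icc] at h2
    have e1 : ((L * N : ℤ) + 1 - (-(L * N : ℤ))).toNat = 2 * (L * N) + 1 := by
      have : ((L * N : ℕ) : ℤ) = (L : ℤ) * N := by push_cast; ring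
      rw [← this]; omega
    rw [e1] at h2
    have h3 : S.card ≤ (3 * (L * N)) * (3 * (L * N)) :=
      h2.trans (Nat.mul_le_mul (by omega) (by omega))
    have h4 : (S.card : ℝ) ≤ 9 * (L ^ 2 * N ^ 2) := by
      have : (S.card : ℝ) ≤ (3 * (L * N)) * (3 * (L * N)) := by exact_mod_cast h3
      linarith
    have h5 : (2 : ℝ) ^ i ≤ 2 ^ e := pow_le_pow_right₀ (by norm_num) hi.le
    calc (S.card : ℝ) * 2 ^ i ≤ 9 * (L ^ 2 * N ^ 2) * 2 ^ e := by gcongr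
      _ ≤ 46656 * (L ^ 2 * N ^ 2) * 2 ^ e := by gcongr; norm_num
      _ = _ := by ring
  · have hp : (2 : ℝ) ^ i = 2 ^ (i - e) * 2 ^ e := by rw [← pow_add]; congr 1; omega
    have heR : 8 * (A : ℝ) ≤ 2 ^ e := by exact_mod_cast he
    have := count a b (L * N) (2 ^ (i - e)) hLN (Nat.one_le_two_pow) (fun q h1 h2 => hsep q h1
      (h2.trans_le (Nat.pow_le_pow_right (by norm_num) (by omega)))) S (by
        intro s hs
        obtain ⟨h1, h2, h3⟩ := hS s hs
        refine ⟨by push_cast; exact h1, by push_cast; exact h2, ?_⟩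
        push_cast
        rw [hp] at h3
        have p0 : (0 : ℝ) < 2 ^ e := by positivity
        have h4 : 8 * (2 ^ (i - e) * 2 ^ e * distNearestInt (s.1 * a + s.2 * b)) ≤ 2 ^ e * 1 := by
          linarith
        refine le_of_mul_le_mul_left (le_trans (le_of_eq ?_) h4) p0
        ring)
    push_cast at this
    rw [hp]
    have p0 : (0 : ℝ) < 2 ^ e := by positivity
    nlinarith

lemma level (a b R : ℝ) (ha : a ≠ 0) (L : ℕ) (hL : 2 * R + 1 ≤ L) (hL2 : 2 ≤ L) :
    ∃ C : ℝ, 0 ≤ C ∧ ∀ (m : ℕ) (Ψ : ℝ), 1 ≤ 4 ^ m * Ψ → Ψ ≤ 1 →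
      (∀ i : ℕ, 4 ^ i * Ψ ≤ 1 → ∀ q : ℕ, 1 ≤ q → q < 2 ^ i →
        1 / ((3 * (L * 2 ^ m) : ℕ) : ℝ) ≤ max (distNearestInt (q * a)) (distNearestInt (q * b))) →
      volume {β : ℝ | |β| ≤ R ∧ ∃ n : ℕ, 2 ^ m ≤ n ∧ n < 2 * 2 ^ m ∧
        distNearestInt (n * (a * β + b)) * distNearestInt (n * β) < Ψ} ≤
      ENNReal.ofReal (C * ((m + 1) * (2 ^ m * Ψ))) := by
  obtain ⟨A, hA⟩ := exists_nat_ge (|a| + 1)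
  obtain ⟨e, he⟩ : ∃ e : ℕ, 8 * A ≤ 2 ^ e := ⟨8 * A, Nat.lt_two_pow_self.le⟩
  have ha0 : 0 < |a| := abs_pos.mpr ha
  set F := Finset.Icc (-(A + 1) : ℤ) (A + 1) with hF
  set K : ℝ := 46656 * L ^ 2 * 2 ^ e with hK
  refine ⟨K * (F.card * (4 * (1 + 1 / |a|))), by positivity, fun m Ψ hm hΨ1 hsep => ?_⟩
  have hΨ0 : 0 < Ψ := by
    by_contra hcon
    have : (4 : ℝ) ^ m * Ψ ≤ 0 := mul_nonpos_of_nonneg_of_nonpos (by positivity) (not_lt.mp hcon)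
    linarith
  set N : ℕ := 2 ^ m with hNdef
  have hN : 1 ≤ N := Nat.one_le_two_pow
  have hN0 : (0 : ℝ) < N := by exact_mod_cast hN
  have hNR : (N : ℝ) = 2 ^ m := by rw [hNdef]; push_cast; ring
  set I := (Finset.range (m + 1)).filter (fun i : ℕ => (4 : ℝ) ^ i * Ψ ≤ 1) with hI
  set S : ℕ → Finset (ℤ × ℤ) := fun i =>
    (Finset.Icc (-(L * N : ℤ)) (L * N) ×ˢ Finset.Icc (-(L * N : ℤ)) (L * N)).filter
      (fun s => (2 : ℝ) ^ i * distNearestInt (s.1 * a + s.2 * b) ≤ A) with hSdef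
  set X : ℕ → ℤ × ℤ → ℤ → Set ℝ := fun i s t =>
    Metric.closedBall ((s.1 : ℝ) / s.2) (2 * Ψ * 2 ^ i / N) ∪
    Metric.closedBall (((round ((s.1 : ℝ) * a + s.2 * b) : ℝ) + t - s.2 * b) / (s.2 * a))
          (2 * Ψ * 2 ^ i / N / |a|) with hX
  have hsub : {β : ℝ | |β| ≤ R ∧ ∃ n : ℕ, N ≤ n ∧ n < 2 * N ∧
        distNearestInt (n * (a * β + b)) * distNearestInt (n * β) < Ψ} ⊆
      ⋃ i ∈ I, ⋃ s ∈ S i, ⋃ t ∈ F, X i s t := by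
    rintro β ⟨hβ, n, hn1, hn2, h⟩
    obtain ⟨i, hi, k, hk, hd, t, ht, hball⟩ :=
      cover a b R ha L A hL hL2 hA N hN Ψ hΨ0 hΨ1 β hβ n hn1 hn2 h
    simp only [Set.mem_iUnion]
    refine ⟨i, ?_, (k, (n : ℤ)), ?_, t, ht, ?_⟩
    · rw [hI, Finset.mem_filter, Finset.mem_range]
      refine ⟨?_, hi⟩
      have h1 : (4 : ℝ) ^ i ≤ 4 ^ m := le_of_mul_le_mul_right (hi.trans hm) hΨ0
      have := (pow_le_pow_iff_right₀ (by norm_num : (1 : ℝ) < 4)).mp h1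
      omega
    · rw [hSdef]
      simp only [Finset.mem_filter, Finset.mem_product, Finset.mem_Icc, ← abs_le]
      refine ⟨⟨hk, ?_⟩, by simpa using hd⟩
      rw [abs_of_nonneg (by positivity)]
      have : n ≤ L * N := hn2.le.trans (Nat.mul_le_mul_right _ hL2)
      exact_mod_cast this
    · simpa [hX] using hball
  refine (measure_mono hsub).trans ?_
  have step : ∀ i ∈ I, volume (⋃ s ∈ S i, ⋃ t ∈ F, X i s t) ≤
      ENNReal.ofReal (K * (F.card * (4 * (1 + 1 / |a|))) * (2 ^ m * Ψ)) := by
    intro i hi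
    rw [hI, Finset.mem_filter] at hi
    have hball : ∀ s t, volume (X i s t) ≤
        ENNReal.ofReal (4 * (1 + 1 / |a|) * (Ψ * 2 ^ i / N)) := by
      intro s t
      refine (measure_union_le _ _).trans ?_
      rw [Real.volume_closedBall, Real.volume_closedBall,
        ← ENNReal.ofReal_add (by positivity) (by positivity)]
      apply ENNReal.ofReal_le_ofReal
      apply le_of_eq
      field_simp
      ring
    refine (union_le (S i) _ _ fun s _ => union_le F _ _ fun t _ => hball s t).trans ?_
    apply ENNReal.ofReal_le_ofReal
    have hc := cardS a b L A e hL2 he N hN i (hsep i hi.2) (S i) (by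
      intro s hs
      rw [hSdef] at hs
      simp only [Finset.mem_filter, Finset.mem_product, Finset.mem_Icc, ← abs_le] at hs
      exact ⟨hs.1.1, hs.1.2, hs.2⟩)
    calc ((S i).card : ℝ) * (F.card * (4 * (1 + 1 / |a|) * (Ψ * 2 ^ i / N)))
        = ((S i).card * 2 ^ i) * (F.card * (4 * (1 + 1 / |a|)) * (Ψ / N)) := by ring
      _ ≤ (K * (N : ℝ) ^ 2) * (F.card * (4 * (1 + 1 / |a|)) * (Ψ / N)) := by
          gcongr
      _ = K * (F.card * (4 * (1 + 1 / |a|))) * (2 ^ m * Ψ) := by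
          rw [← hNR]; field_simp
  refine (union_le I _ _ step).trans ?_
  apply ENNReal.ofReal_le_ofReal
  have hIc : (I.card : ℝ) ≤ m + 1 := by
    have : I.card ≤ m + 1 := by
      have := Finset.card_filter_le (Finset.range (m + 1)) (fun i : ℕ => (4 : ℝ) ^ i * Ψ ≤ 1)
      rwa [Finset.card_range] at this
    exact_mod_cast this
  calc (I.card : ℝ) * (K * (F.card * (4 * (1 + 1 / |a|))) * (2 ^ m * Ψ))
      ≤ (m + 1) * (K * (F.card * (4 * (1 + 1 / |a|))) * (2 ^ m * Ψ)) := by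
        gcongr
    _ = _ := by ring

lemma cond_sum (ψ : ℕ → ℝ) (hψ0 : ∀ n, 0 ≤ ψ n) (hψmono : Antitone ψ)
    (hψsum : Summable fun n : ℕ => ψ n * Real.log n) :
    Summable fun m : ℕ => ((m : ℝ) + 1) * (2 ^ m * ψ (2 ^ m)) := by
  have hl0 : 0 < Real.log 2 := Real.log_pos (by norm_num)
  have hnn : ∀ n : ℕ, 0 ≤ ψ n * Real.log n := fun n =>
    mul_nonneg (hψ0 n) (Real.log_natCast_nonneg n)
  have hpart : ∀ M : ℕ, ∑ m ∈ Finset.range M, (2 : ℝ) ^ m * (ψ (2 ^ (m + 1)) * (m * Real.log 2)) ≤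
      ∑ n ∈ Finset.range (2 ^ M), ψ n * Real.log n := by
    intro M
    induction M with
    | zero => simp
    | succ M ih =>
      have hle : 2 ^ M ≤ 2 ^ (M + 1) := Nat.pow_le_pow_right (by norm_num) (by omega)
      rw [Finset.sum_range_succ, ← Finset.sum_range_add_sum_Ico _ hle]
      refine add_le_add ih ?_
      calc (2 : ℝ) ^ M * (ψ (2 ^ (M + 1)) * (M * Real.log 2))
          = ∑ n ∈ Finset.Ico (2 ^ M) (2 ^ (M + 1)), ψ (2 ^ (M + 1)) * (M * Real.log 2) := by
            rw [Finset.sum_const, Nat.card_Ico, nsmul_eq_mul]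
            have : 2 ^ (M + 1) - 2 ^ M = 2 ^ M := by rw [pow_succ]; omega
            rw [this]; push_cast; ring
        _ ≤ _ := by
            apply Finset.sum_le_sum
            intro n hn
            rw [Finset.mem_Ico] at hn
            have h1 : (M : ℝ) * Real.log 2 ≤ Real.log n := by
              rw [← Real.log_pow]
              apply Real.log_le_log (by positivity)
              exact_mod_cast hn.1
            exact mul_le_mul (hψmono hn.2.le) h1 (by positivity) (hψ0 n)
  have hs : Summable fun m : ℕ => (2 : ℝ) ^ m * (ψ (2 ^ (m + 1)) * (m * Real.log 2)) := by
    refine summable_of_sum_range_le (c := ∑' n : ℕ, ψ n * Real.log n)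
      (fun m => ?_) (fun M => (hpart M).trans (hψsum.sum_le_tsum _ fun n _ => hnn n))
    have := hψ0 (2 ^ (m + 1))
    positivity
  have hs1 := (summable_nat_add_iff 1).mpr hs
  rw [← summable_nat_add_iff 2]
  refine Summable.of_nonneg_of_le (fun m => ?_) (fun m => ?_) (hs1.mul_left (6 / Real.log 2))
  · have := hψ0 (2 ^ (m + 2))
    positivity
  · have := hψ0 (2 ^ (m + 2))
    have e : 6 / Real.log 2 * ((2 : ℝ) ^ (m + 1) * (ψ (2 ^ (m + 1 + 1)) * (((m + 1 : ℕ) : ℝ) * Real.log 2)))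
      = (6 * ((m : ℝ) + 1)) * (2 ^ (m + 1) * ψ (2 ^ (m + 2))) := by
      push_cast
      field_simp
    rw [e]
    have e2 : (((m + 2 : ℕ) : ℝ) + 1) * (2 ^ (m + 2) * ψ (2 ^ (m + 2))) =
      (2 * ((m : ℝ) + 3)) * (2 ^ (m + 1) * ψ (2 ^ (m + 2))) := by
      push_cast; ring
    rw [e2]
    have : (0 : ℝ) ≤ m := by positivity
    refine mul_le_mul_of_nonneg_right (by linarith) (by positivity)

lemma params (s : ℝ) (hs1 : 1 / 2 ≤ s) (hs2 : s < 1) :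
    ∃ r τ : ℝ, 1 / 2 ≤ r ∧ r < 1 ∧ 0 < τ ∧ τ < 2 ∧ (2 / r) ^ s = τ := by
  set ρ := (1 + 1 / s) / 2 with hρ
  have hs0 : 0 < s := by linarith
  have h1 : 1 < 1 / s := by rw [lt_div_iff₀ hs0]; linarith
  have h2 : 1 / s ≤ 2 := by rw [div_le_iff₀ hs0]; linarith
  refine ⟨2 ^ (1 - ρ), 2 ^ (ρ * s), ?_, ?_, by positivity, ?_, ?_⟩
  · have : (1 / 2 : ℝ) = 2 ^ (-1 : ℝ) := by rw [Real.rpow_neg_one]; norm_num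
    rw [this]
    apply Real.rpow_le_rpow_of_exponent_le (by norm_num)
    linarith
  · apply Real.rpow_lt_one_of_one_lt_of_neg (by norm_num)
    linarith
  · have : (2 : ℝ) ^ (ρ * s) < 2 ^ (1 : ℝ) := by
      apply Real.rpow_lt_rpow_of_exponent_lt (by norm_num)
      have : ρ * s = (s + 1) / 2 := by rw [hρ]; field_simp
      linarith
    simpa using this
  · have : (2 : ℝ) / 2 ^ (1 - ρ) = 2 ^ ρ := by
      rw [Real.rpow_sub (by norm_num), Real.rpow_one]; field_simp
    rw [this, ← Real.rpow_mul (by norm_num)]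

lemma bounded_version (a b : ℝ) (hab : DualExpLtFive a b)
    (ψ : ℕ → ℝ) (hψ0 : ∀ n, 0 ≤ ψ n) (hψmono : Antitone ψ)
    (hψsum : Summable fun n : ℕ => ψ n * Real.log n) (R : ℕ) :
    ∀ᵐ β : ℝ ∂(volume : Measure ℝ), |β| ≤ (R : ℝ) →
      {n : ℕ | 0 < n ∧
        distNearestInt (n * (a * β + b)) * distNearestInt (n * β) < ψ n}.Finite := by
  obtain ⟨w, c, hw5, hw3, hc, hdual⟩ := dual_lower a b hab
  have ha : a ≠ 0 := by
    rintro rfl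
    have := hdual (1, 0) (by simp)
    simp [distNearestInt] at this
    linarith
  have htr := transfer a b w c hw3 hc hdual
  set c' := c * 2 ^ (-w) / 2 with hc'
  have hc'0 : 0 < c' := by positivity
  set s := (w - 1) / 4 with hs
  obtain ⟨r, τ, hr1, hr2, hτ0, hτ2, hrτ⟩ := params s (by linarith) (by linarith)
  have hr0 : 0 < r := by linarith
  set L := 2 * R + 2 with hL
  obtain ⟨C, hC0, hlev⟩ := level a b R ha L (by rw [hL]; push_cast; linarith) (by omega)
  set Ψ : ℕ → ℝ := fun m => ψ (2 ^ m) + (r / 2) ^ m with hΨ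
  have hΨpos : ∀ m, 0 < Ψ m := fun m => add_pos_of_nonneg_of_pos (hψ0 _) (by positivity)
  have hsum : Summable fun m : ℕ => ((m : ℝ) + 1) * (2 ^ m * Ψ m) := by
    have h1 := cond_sum ψ hψ0 hψmono hψsum
    have hrn : ‖r‖ < 1 := by rw [Real.norm_eq_abs, abs_of_pos hr0]; exact hr2
    have h2 := (summable_pow_mul_geometric_of_norm_lt_one 1 hrn).add
      (summable_geometric_of_norm_lt_one hrn)
    refine (h1.add h2).congr fun m => ?_
    rw [hΨ]
    simp only [div_pow]
    field_simp
    try ring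
  have hev1 : ∀ᶠ m : ℕ in Filter.atTop, ((m : ℝ) + 1) * (2 ^ m * Ψ m) < 1 :=
    hsum.tendsto_atTop_zero.eventually_lt_const one_pos
  have hev2 : ∀ᶠ m : ℕ in Filter.atTop, (τ / 2) ^ m < c' * (3 * L) := by
    have := tendsto_pow_atTop_nhds_zero_of_lt_one (r := τ / 2) (by positivity) (by linarith)
    exact this.eventually_lt_const (by positivity)
  obtain ⟨m0, hm0⟩ := Filter.eventually_atTop.mp (hev1.and hev2)
  set B : ℕ → Set ℝ := fun m => {β : ℝ | |β| ≤ R ∧ ∃ n : ℕ, 2 ^ m ≤ n ∧ n < 2 * 2 ^ m ∧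
        distNearestInt (n * (a * β + b)) * distNearestInt (n * β) < Ψ m} with hB
  have hBm : ∀ m, m0 ≤ m → volume (B m) ≤
      ENNReal.ofReal (C * (((m : ℝ) + 1) * (2 ^ m * Ψ m))) := by
    intro m hm
    obtain ⟨e1, e2⟩ := hm0 m hm
    apply hlev m (Ψ m)
    · have h1 : (1 : ℝ) ≤ (2 * r) ^ m := one_le_pow₀ (by linarith)
      have h2 : (2 * r) ^ m = 4 ^ m * (r / 2) ^ m := by rw [← mul_pow]; congr 1; ring
      have h3 : (4 : ℝ) ^ m * (r / 2) ^ m ≤ 4 ^ m * Ψ m := by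
        gcongr
        exact le_add_of_nonneg_left (hψ0 _)
      linarith
    · have h1 : (1 : ℝ) ≤ 2 ^ m := one_le_pow₀ (by norm_num)
      have h2 : Ψ m ≤ 2 ^ m * Ψ m := le_mul_of_one_le_left (hΨpos m).le h1
      have h3 : 2 ^ m * Ψ m ≤ ((m : ℝ) + 1) * (2 ^ m * Ψ m) :=
        le_mul_of_one_le_left (by have := hΨpos m; positivity) (by linarith [Nat.cast_nonneg (α := ℝ) m])
      linarith
    · intro i hi q hq1 hq2
      refine le_trans ?_ (htr q hq1)
      have hq0 : (0 : ℝ) < q := by exact_mod_cast hq1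
      have hqi : (q : ℝ) ≤ 2 ^ i := by exact_mod_cast hq2.le
      have h4 : (4 : ℝ) ^ i ≤ (2 / r) ^ m := by
        have h5 : (4 : ℝ) ^ i * (r / 2) ^ m ≤ 1 := by
          refine le_trans ?_ hi
          gcongr
          exact le_add_of_nonneg_left (hψ0 _)
        have h6 : (2 / r) ^ m * (r / 2) ^ m = 1 := by
          rw [← mul_pow]
          have : 2 / r * (r / 2) = 1 := by field_simp
          rw [this, one_pow]
        rw [← h6] at h5
        exact le_of_mul_le_mul_right h5 (by positivity)
      have hqσ : (q : ℝ) ^ ((w - 1) / 2) ≤ τ ^ m := by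
        have e : (q : ℝ) ^ ((w - 1) / 2) = ((q : ℝ) ^ 2) ^ s := by
          rw [← Real.rpow_natCast, ← Real.rpow_mul hq0.le]
          congr 1
          rw [hs]; push_cast; ring
        rw [e]
        have h7 : (q : ℝ) ^ 2 ≤ (2 / r) ^ m := by
          refine le_trans ?_ h4
          calc (q : ℝ) ^ 2 ≤ (2 ^ i) ^ 2 := by gcongr
            _ = 4 ^ i := by rw [← pow_mul, mul_comm, pow_mul]; norm_num
        calc ((q : ℝ) ^ 2) ^ s ≤ ((2 / r) ^ m) ^ s :=
              Real.rpow_le_rpow (by positivity) h7 (by linarith)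
          _ = ((2 / r) ^ s) ^ m := by
              rw [← Real.rpow_natCast, ← Real.rpow_natCast, ← Real.rpow_mul (by positivity),
                ← Real.rpow_mul (by positivity), mul_comm]
          _ = τ ^ m := by rw [hrτ]
      rw [Real.rpow_neg hq0.le, ← div_eq_mul_inv,
        div_le_div_iff₀ (by positivity) (by positivity), one_mul]
      refine hqσ.trans ?_
      rw [div_pow, div_lt_iff₀ (by positivity)] at e2
      push_cast
      linarith
  have hBC : ∑' m, volume (B (m + m0)) ≠ ⊤ := by
    refine ne_top_of_le_ne_top ?_ (ENNReal.tsum_le_tsum fun m => hBm (m + m0) (by omega))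
    exact (((summable_nat_add_iff m0).mpr (hsum.mul_left C))).tsum_ofReal_ne_top
  filter_upwards [ae_eventually_notMem hBC] with β hβ hβR
  obtain ⟨m1, hm1⟩ := Filter.eventually_atTop.mp hβ
  refine (Set.finite_lt_nat (2 ^ (m1 + m0))).subset ?_
  rintro n ⟨hn0, hn⟩
  rw [Set.mem_setOf_eq]
  by_contra hcon
  rw [not_lt] at hcon
  have hlog : m1 + m0 ≤ Nat.log 2 n := Nat.le_log_of_pow_le (by norm_num) hcon
  have hp := Nat.pow_log_le_self 2 hn0.ne'
  have hp2 := Nat.lt_pow_succ_log_self (b := 2) (by norm_num) n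
  have := hm1 (Nat.log 2 n - m0) (by omega)
  have e : Nat.log 2 n - m0 + m0 = Nat.log 2 n := by omega
  rw [e] at this
  apply this
  refine ⟨hβR, n, hp, by rw [pow_succ] at hp2; omega, ?_⟩
  refine hn.trans_le ((hψmono hp).trans ?_)
  exact le_add_of_nonneg_right (by positivity)

/-- **Convergence theorem** (Chow–Yang, Theorem 1.5). -/
theorem convergence_on_lines_dual (a b : ℝ) (hab : DualExpLtFive a b)
    (ψ : ℕ → ℝ) (hψ0 : ∀ n, 0 ≤ ψ n) (hψmono : Antitone ψ)
    (hψsum : Summable fun n : ℕ => ψ n * Real.log n) :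
    ∀ᵐ β ∂(volume : Measure ℝ),
      {n : ℕ | 0 < n ∧
        distNearestInt (n * (a * β + b)) * distNearestInt (n * β) < ψ n}.Finite := by
  have h := ae_all_iff.mpr fun R : ℕ => bounded_version a b hab ψ hψ0 hψmono hψsum R
  filter_upwards [h] with β hβ
  obtain ⟨R, hR⟩ := exists_nat_ge |β|
  exact hβ R hR

end
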